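/- Fix 0 < ω < 1/2 and 0 < τ < 1/2 − √(ω−ω²). Then ε₀/ε₁ = −(1+z₁)/(1−z₁)·(1 + O(w^{−1/2})): there exist C > 0 and N such that for all n ≥ N, with w = ⌊ωn⌋ and t = ⌊τn⌋, the quantity z₁ is a real number in (−1,0) and | (ε₀(n,w,t)/ε₁(n,w,t))·(1−z₁)/(1+z₁) + 1 | ≤ C·w^{−1/2}. -/

import Mathlib

open Finset

/-- The bias of statistical decoding on an error position. -/
noncomputable def eps1 (n w t : ℕ) : ℝ :=
  (∑ j ∈ Finset.range w,
      if Even j then ((t - 1).choose j * (n - t).choose (w - 1 - j) : ℝ) else 0) /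
    ((n - 1).choose (w - 1) : ℝ) - 1 / 2

/-- The bias of statistical decoding on a non-error position. -/
noncomputable def eps0 (n w t : ℕ) : ℝ :=
  (∑ j ∈ Finset.range w,
      if Odd j then (t.choose j * (n - t - 1).choose (w - 1 - j) : ℝ) else 0) /
    ((n - 1).choose (w - 1) : ℝ) - 1 / 2

open Polynomial in
/-- The generating polynomial of the Krawtchouk numbers. -/
noncomputable def krawtchoukGen (i l : ℕ) : ℝ[X] := (1 - X) ^ i * (1 + X) ^ l

/-- The value at `i` of the Krawtchouk polynomial of degree `v` for length `m`. -/
noncomputable def krawtchouk (m v i : ℕ) : ℝ := (krawtchoukGen i (m - i)).coeff v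

open Polynomial in
lemma coeff_one_sub_X_pow_real (i j : ℕ) :
    ((1 - X : ℝ[X]) ^ i).coeff j = (-1) ^ j * (i.choose j : ℝ) := by
  have h : (1 - X : ℝ[X]) ^ i = ((1 + X : ℝ[X]) ^ i).comp (C (-1) * X) := by
    simp [sub_eq_add_neg]
  rw [h, comp_C_mul_X_coeff, coeff_one_add_X_pow, mul_comm]

lemma krawtchouk_eq_sum (m v i : ℕ) :
    krawtchouk m v i =
      ∑ j ∈ Finset.range (v + 1), (-1) ^ j * ((i.choose j : ℝ) * ((m - i).choose (v - j) : ℝ)) := by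
  rw [krawtchouk, krawtchoukGen, Polynomial.coeff_mul,
    Finset.Nat.sum_antidiagonal_eq_sum_range_succ_mk]
  refine Finset.sum_congr rfl fun j _ => ?_
  rw [coeff_one_sub_X_pow_real, Polynomial.coeff_one_add_X_pow, mul_assoc]

lemma sum_choose_mul_choose {m v i : ℕ} (hi : i ≤ m) :
    ∑ j ∈ Finset.range (v + 1), ((i.choose j : ℝ) * ((m - i).choose (v - j) : ℝ)) =
      (m.choose v : ℝ) := by
  have h := Nat.add_choose_eq i (m - i) v
  rw [Nat.add_sub_cancel' hi, Finset.Nat.sum_antidiagonal_eq_sum_range_succ_mk] at h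
  rw [h]
  push_cast
  rfl

lemma sum_even_choose_mul_choose {m v i : ℕ} (hi : i ≤ m) :
    ∑ j ∈ Finset.range (v + 1),
      (if Even j then ((i.choose j : ℝ) * ((m - i).choose (v - j) : ℝ)) else 0) =
      ((m.choose v : ℝ) + krawtchouk m v i) / 2 := by
  rw [krawtchouk_eq_sum, ← sum_choose_mul_choose hi, ← Finset.sum_add_distrib, Finset.sum_div]
  refine Finset.sum_congr rfl fun j _ => ?_
  split_ifs with h
  · rw [h.neg_one_pow]; ring
  · rw [(Nat.not_even_iff_odd.1 h).neg_one_pow]; ring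

lemma sum_odd_choose_mul_choose {m v i : ℕ} (hi : i ≤ m) :
    ∑ j ∈ Finset.range (v + 1),
      (if Odd j then ((i.choose j : ℝ) * ((m - i).choose (v - j) : ℝ)) else 0) =
      ((m.choose v : ℝ) - krawtchouk m v i) / 2 := by
  rw [krawtchouk_eq_sum, ← sum_choose_mul_choose hi, ← Finset.sum_sub_distrib, Finset.sum_div]
  refine Finset.sum_congr rfl fun j _ => ?_
  split_ifs with h
  · rw [h.neg_one_pow]; ring
  · rw [(Nat.not_odd_iff_even.1 h).neg_one_pow]; ring

lemma eps1_eq_krawtchouk {m v k : ℕ} (hv : v ≤ m) (hk : k ≤ m) :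
    eps1 (m + 1) (v + 1) (k + 1) = krawtchouk m v k / (2 * (m.choose v : ℝ)) := by
  have hc : (m.choose v : ℝ) ≠ 0 := by exact_mod_cast (Nat.choose_pos hv).ne'
  have h := sum_even_choose_mul_choose (v := v) hk
  simp only [eps1, Nat.add_sub_cancel, Nat.add_sub_add_right]
  rw [h]
  field_simp
  ring

lemma eps0_eq_krawtchouk {m v k : ℕ} (hv : v ≤ m) (hk : k ≤ m) :
    eps0 (m + 1) (v + 1) k = -(krawtchouk m v k / (2 * (m.choose v : ℝ))) := by
  have hc : (m.choose v : ℝ) ≠ 0 := by exact_mod_cast (Nat.choose_pos hv).ne'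
  have h := sum_odd_choose_mul_choose (v := v) hk
  have h1 : m + 1 - k - 1 = m - k := by omega
  simp only [eps0, Nat.add_sub_cancel, h1]
  rw [h]
  field_simp
  ring

open Polynomial in
lemma coeff_X_mul_derivative (f : ℝ[X]) (v : ℕ) :
    (X * derivative f).coeff v = v * f.coeff v := by
  cases v with
  | zero => simp
  | succ v => rw [coeff_X_mul, coeff_derivative]; push_cast; ring

lemma krawtchouk_zero_right (m v : ℕ) : krawtchouk m v 0 = (m.choose v : ℝ) := by
  simp [krawtchouk, krawtchoukGen, Polynomial.coeff_one_add_X_pow]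

open Polynomial in
lemma krawtchouk_one_right {m : ℕ} (v : ℕ) (hm : 1 ≤ m) :
    (m : ℝ) * krawtchouk m v 1 = ((m : ℝ) - 2 * v) * krawtchouk m v 0 := by
  obtain ⟨l, rfl⟩ := Nat.exists_eq_add_of_le' hm
  have key : C ((l : ℝ) + 1) * krawtchoukGen 1 l =
      C ((l : ℝ) + 1) * krawtchoukGen 0 (l + 1)
        - C 2 * (X * derivative (krawtchoukGen 0 (l + 1))) := by
    simp only [krawtchoukGen, derivative_mul, derivative_pow, derivative_sub,
      derivative_one, derivative_X, Nat.add_sub_cancel, map_add, map_natCast, map_one, map_ofNat]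
    push_cast
    ring
  have h := congrArg (fun f => coeff f v) key
  simp only [coeff_sub, coeff_C_mul, coeff_X_mul_derivative] at h
  simp only [krawtchouk, Nat.add_sub_cancel, Nat.sub_zero]
  push_cast
  linear_combination h

open Polynomial in
lemma krawtchouk_add_two {m k : ℕ} (v : ℕ) (hk : k + 2 ≤ m) :
    ((m : ℝ) - (k + 1)) * krawtchouk m v (k + 2) =
      ((m : ℝ) - 2 * v) * krawtchouk m v (k + 1) - (k + 1) * krawtchouk m v k := by
  obtain ⟨l, rfl⟩ := Nat.exists_eq_add_of_le' hk
  have key : C ((l : ℝ) + 1) * krawtchoukGen (k + 2) l =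
      C ((l : ℝ) + k + 2) * krawtchoukGen (k + 1) (l + 1)
        - C 2 * (X * derivative (krawtchoukGen (k + 1) (l + 1)))
        - C ((k : ℝ) + 1) * krawtchoukGen k (l + 2) := by
    simp only [krawtchoukGen, derivative_mul, derivative_pow, derivative_sub,
      derivative_one, derivative_X, Nat.add_sub_cancel, map_add, map_natCast, map_one, map_ofNat]
    push_cast
    ring
  have h := congrArg (fun f => coeff f v) key
  simp only [coeff_sub, coeff_C_mul, coeff_X_mul_derivative] at h
  have e0 : l + (k + 2) - k = l + 2 := by omega
  have e1 : l + (k + 2) - (k + 1) = l + 1 := by omega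
  simp only [krawtchouk, Nat.add_sub_cancel, e0, e1]
  push_cast
  linear_combination h

/-- The larger root of `(m - i) r² - a r + i`. -/
noncomputable def largeRoot (m a i : ℝ) : ℝ :=
  (a + √(a ^ 2 - 4 * i * (m - i))) / (2 * (m - i))

/-- The data common to all estimates on `largeRoot`: the discriminant is at least `(κ m)²`. -/
structure RootRegime (κ m a i : ℝ) : Prop where
  kappa_pos : 0 < κ
  kappa_mul : 2 ≤ κ * m
  four_le : 4 ≤ m
  pos : 0 ≤ a
  le : a ≤ m
  nonneg : 0 ≤ i
  two_mul_le : 2 * i ≤ m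
  disc : (κ * m) ^ 2 ≤ a ^ 2 - 4 * i * (m - i)

namespace RootRegime

variable {κ m a i : ℝ}

lemma sq_sqrt (h : RootRegime κ m a i) :
    √(a ^ 2 - 4 * i * (m - i)) ^ 2 = a ^ 2 - 4 * i * (m - i) :=
  Real.sq_sqrt ((sq_nonneg _).trans h.disc)

lemma le_sqrt (h : RootRegime κ m a i) : κ * m ≤ √(a ^ 2 - 4 * i * (m - i)) :=
  Real.le_sqrt_of_sq_le h.disc

lemma sqrt_le (h : RootRegime κ m a i) : √(a ^ 2 - 4 * i * (m - i)) ≤ a := by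
  have := h.four_le
  have := h.two_mul_le
  refine Real.sqrt_le_iff.2 ⟨h.pos, ?_⟩
  nlinarith [mul_nonneg h.nonneg (by linarith : 0 ≤ m - i)]

lemma kappa_le_largeRoot (h : RootRegime κ m a i) : κ ≤ largeRoot m a i := by
  have h4 := h.four_le
  have h2 := h.two_mul_le
  have := h.le_sqrt
  have := h.sqrt_le
  rw [largeRoot, le_div_iff₀ (by linarith)]
  nlinarith [mul_nonneg h.kappa_pos.le h.nonneg]

lemma largeRoot_pos (h : RootRegime κ m a i) : 0 < largeRoot m a i :=
  h.kappa_pos.trans_le h.kappa_le_largeRoot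

lemma largeRoot_le_one (h : RootRegime κ m a i) : largeRoot m a i ≤ 1 := by
  have h4 := h.four_le
  have h2 := h.two_mul_le
  have h3 := h.le
  rw [largeRoot, div_le_one (by linarith), ← le_sub_iff_add_le', Real.sqrt_le_iff]
  exact ⟨by linarith, by nlinarith [mul_nonneg (by linarith : 0 ≤ m - i) (by linarith : 0 ≤ m - a)]⟩

lemma largeRoot_root (h : RootRegime κ m a i) :
    (m - i) * largeRoot m a i ^ 2 = a * largeRoot m a i - i := by
  have h4 := h.four_le
  have h2 := h.two_mul_le
  have h5 : m - i ≠ 0 := by linarith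
  have hs := h.sq_sqrt
  rw [largeRoot]
  generalize √(a ^ 2 - 4 * i * (m - i)) = s at *
  field_simp
  linear_combination hs

/-- The linearised step of the ratio recursion contracts by at least `1 - κ`. -/
lemma contraction (h : RootRegime κ m a i) :
    i ≤ (1 - κ) * ((m - i) * largeRoot m a i ^ 2) := by
  have h4 := h.four_le
  have h2 := h.two_mul_le
  have h5 : 0 < m - i := by linarith
  have hs := h.sq_sqrt
  have hl := h.le_sqrt
  have hu := h.sqrt_le
  have ha := h.le
  have hk := h.kappa_pos
  have hkm := h.kappa_mul
  rw [largeRoot]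
  generalize √(a ^ 2 - 4 * i * (m - i)) = s at *
  have e : (m - i) * ((a + s) / (2 * (m - i))) ^ 2 = (a + s) ^ 2 / (4 * (m - i)) := by
    field_simp; ring
  rw [e, ← mul_div_assoc, le_div_iff₀ (by linarith)]
  have e1 : i * (4 * (m - i)) = (a - s) * (a + s) := by linear_combination hs
  rw [e1, sq, ← mul_assoc]
  refine mul_le_mul_of_nonneg_right ?_ (by linarith)
  nlinarith [mul_nonneg hk.le (by linarith : 0 ≤ m - a), mul_nonneg hk.le (by linarith : 0 ≤ a - s)]

/-- `largeRoot` decreases slowly in its last argument. -/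
lemma largeRoot_succ (h : RootRegime κ m a i) (h' : RootRegime κ m a (i + 1)) :
    largeRoot m a (i + 1) ≤ largeRoot m a i ∧
      largeRoot m a i ≤ largeRoot m a (i + 1) + 8 / (κ * m) := by
  have h4 := h.four_le
  have h2 := h.two_mul_le
  have h2' := h'.two_mul_le
  have hk := h.kappa_pos
  have hkm := h.kappa_mul
  have h5 : 0 < m - i := by linarith
  have h6 : m / 4 ≤ m - (i + 1) := by linarith
  have h6' : 0 < m - (i + 1) := by linarith
  have hR := h.largeRoot_pos
  have hR1 := h.largeRoot_le_one
  have hroot := h.largeRoot_root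
  have hroot' := h'.largeRoot_root
  have hs := h.le_sqrt
  have hs' := h'.le_sqrt
  have hsa := h.sqrt_le
  have ham := h.le
  have hgap : κ / 2 ≤ largeRoot m a i - (a / (m - (i + 1)) - largeRoot m a (i + 1)) := by
    rw [largeRoot, largeRoot]
    generalize √(a ^ 2 - 4 * i * (m - i)) = s at *
    generalize √(a ^ 2 - 4 * (i + 1) * (m - (i + 1))) = s' at *
    have e : (a + s) / (2 * (m - i)) - (a / (m - (i + 1)) - (a + s') / (2 * (m - (i + 1)))) =
        s / (2 * (m - i)) + (s' * (m - i) - a) / (2 * (m - i) * (m - (i + 1))) := by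
      field_simp
      ring
    rw [e]
    have t1 : κ / 2 ≤ s / (2 * (m - i)) := by
      rw [le_div_iff₀ (by linarith)]
      nlinarith [mul_nonneg hk.le h.nonneg]
    have t2 : 0 ≤ (s' * (m - i) - a) / (2 * (m - i) * (m - (i + 1))) := by
      refine div_nonneg ?_ (by positivity)
      nlinarith [mul_le_mul (by linarith : (2 : ℝ) ≤ s') (by linarith : m / 2 ≤ m - i)
        (by linarith) (by linarith)]
    linarith
  have hprod : (largeRoot m a i - largeRoot m a (i + 1)) *
      ((m - (i + 1)) * (largeRoot m a i - (a / (m - (i + 1)) - largeRoot m a (i + 1)))) =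
      1 - largeRoot m a i ^ 2 := by
    generalize largeRoot m a i = R at *
    generalize largeRoot m a (i + 1) = R' at *
    field_simp
    linear_combination hroot - hroot'
  generalize largeRoot m a i = R at *
  generalize largeRoot m a (i + 1) = R' at *
  generalize R - (a / (m - (i + 1)) - R') = g at *
  have hG : κ * m / 8 ≤ (m - (i + 1)) * g := by
    nlinarith [mul_le_mul h6 hgap (by linarith) (by linarith)]
  have hm : 0 < κ * m := by linarith
  have hle : R' ≤ R := by
    by_contra! hlt
    nlinarith [mul_pos (by linarith : 0 < R' - R) (by linarith : 0 < (m - (i + 1)) * g)]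
  refine ⟨hle, ?_⟩
  rw [← sub_le_iff_le_add', le_div_iff₀ hm]
  nlinarith [mul_le_mul_of_nonneg_left hG (by linarith : 0 ≤ R - R')]

lemma mono (h : RootRegime κ m a i) {j : ℝ} (hj : 0 ≤ j) (hji : j ≤ i) :
    RootRegime κ m a j where
  kappa_pos := h.kappa_pos
  kappa_mul := h.kappa_mul
  four_le := h.four_le
  pos := h.pos
  le := h.le
  nonneg := hj
  two_mul_le := by linarith [h.two_mul_le]
  disc := by
    have := h.disc
    have := h.two_mul_le
    nlinarith [mul_nonneg (by linarith : 0 ≤ i - j) (by linarith : 0 ≤ m - i - j)]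

end RootRegime

/-- Solutions of the Krawtchouk recurrence have consecutive ratios close to `largeRoot`. -/
lemma ratio_bounds_of_recurrence {κ m a : ℝ} {p : ℕ → ℝ} {K : ℕ}
    (hK : RootRegime κ m a K) (hp0 : 0 < p 0) (hp1 : m * p 1 = a * p 0)
    (hrec : ∀ k < K, (m - (k + 1)) * p (k + 2) = a * p (k + 1) - (k + 1) * p k) :
    ∀ k ≤ K, 0 < p k ∧ largeRoot m a k * p k ≤ p (k + 1) ∧
      p (k + 1) ≤ (largeRoot m a k + 8 / (κ ^ 2 * m)) * p k := by
  have hκ := hK.kappa_pos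
  have hm : 0 < m := by linarith [hK.four_le]
  intro k
  induction k with
  | zero =>
    intro _
    have h0 : largeRoot m a 0 = a / m := by
      simp only [largeRoot, mul_zero, zero_mul, sub_zero, Real.sqrt_sq hK.pos]
      field_simp
      ring
    have h1 : p 1 = a / m * p 0 := by
      field_simp
      linear_combination hp1
    have : 0 < 8 / (κ ^ 2 * m) := by positivity
    simp only [Nat.cast_zero, h0, zero_add, h1]
    exact ⟨hp0, le_rfl, by nlinarith⟩
  | succ k ih =>
    intro hk
    obtain ⟨ih0, ih1, ih2⟩ := ih (by omega)
    have hkK : ((k : ℝ) + 1) ≤ K := by exact_mod_cast hk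
    have hk0 : (0 : ℝ) ≤ k := k.cast_nonneg
    have H : RootRegime κ m a k := hK.mono hk0 (by linarith)
    have H' : RootRegime κ m a (k + 1) := hK.mono (by linarith) hkK
    obtain ⟨d1, d2⟩ := H.largeRoot_succ H'
    have hr := hrec k (by omega)
    have hroot := H'.largeRoot_root
    have hcon := H'.contraction
    have hRk := H.largeRoot_pos
    have hR := H'.largeRoot_pos
    have hmk : 0 < m - ((k : ℝ) + 1) := by linarith [H'.two_mul_le]
    push_cast
    rw [show k + 1 + 1 = k + 2 from rfl]
    generalize largeRoot m a k = R₀ at *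
    generalize largeRoot m a (k + 1) = R at *
    have hp : 0 < p (k + 1) := (mul_pos hRk ih0).trans_le ih1
    have hRp : R * p k ≤ p (k + 1) := by nlinarith
    -- the exact error propagation
    have hstep : (m - (k + 1)) * R * (p (k + 2) - R * p (k + 1)) =
        (k + 1) * (p (k + 1) - R * p k) := by
      linear_combination R * hr - p (k + 1) * hroot
    have hpos : 0 < (m - (k + 1)) * R := mul_pos hmk hR
    refine ⟨hp, ?_, ?_⟩
    · have : 0 ≤ (m - (k + 1)) * R * (p (k + 2) - R * p (k + 1)) := by
        rw [hstep]
        exact mul_nonneg (by linarith) (by linarith)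
      linarith [nonneg_of_mul_nonneg_right this hpos]
    · set E := 8 / (κ ^ 2 * m) with hE
      have hE0 : 0 < E := by positivity
      have hκE : 8 / (κ * m) = κ * E := by
        rw [hE]; field_simp
      rw [hκE] at d2
      have hδ : p (k + 1) - R * p k ≤ (1 + κ) * E * p k := by nlinarith
      have h1 : (m - (k + 1)) * R * (p (k + 2) - R * p (k + 1)) ≤
          (m - (k + 1)) * R * (E * p (k + 1)) := by
        have hκ1 : 0 ≤ 1 - κ := by
          by_contra! hc
          nlinarith [mul_pos hpos hR]
        calc (m - (k + 1)) * R * (p (k + 2) - R * p (k + 1))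
            = (k + 1) * (p (k + 1) - R * p k) := hstep
          _ ≤ (1 - κ) * ((m - (k + 1)) * R ^ 2) * (p (k + 1) - R * p k) :=
              mul_le_mul_of_nonneg_right hcon (by linarith)
          _ ≤ (1 - κ) * ((m - (k + 1)) * R ^ 2) * ((1 + κ) * E * p k) :=
              mul_le_mul_of_nonneg_left hδ (by positivity)
          _ = (m - (k + 1)) * R * E * (R * p k) * (1 - κ ^ 2) := by ring
          _ ≤ (m - (k + 1)) * R * E * (R * p k) * 1 :=
              mul_le_mul_of_nonneg_left (by nlinarith) (by positivity)
          _ ≤ (m - (k + 1)) * R * (E * p (k + 1)) := by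
              have := mul_le_mul_of_nonneg_left hRp (mul_pos hpos hE0).le
              linarith
      linarith [le_of_mul_le_mul_left h1 hpos]

lemma saddle_point_mem_and_eq {m v K z s : ℝ} (hv : 0 < v) (hvm : 2 * v ≤ m) (hK : 0 ≤ K)
    (hKm : 2 * K < m) (hs : 0 < s) (hs2 : s ^ 2 = (m - 2 * v) ^ 2 - 4 * K * (m - K))
    (hz : z = (-(m - 2 * K) + s) / (2 * (m - v))) :
    z ∈ Set.Ioo (-1 : ℝ) 0 ∧ (m - 2 * v + s) / (2 * (m - K)) * (1 - z) = 1 + z := by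
  have hmv : 0 < m - v := by linarith
  have hmK : 0 < m - K := by linarith
  subst hz
  refine ⟨⟨?_, ?_⟩, ?_⟩
  · rw [lt_div_iff₀ (by linarith)]
    linarith
  · refine div_neg_of_neg_of_pos ?_ (by linarith)
    have : s < m - 2 * K := lt_of_pow_lt_pow_left₀ 2 (by linarith) (by nlinarith [mul_pos hv hmv])
    linarith
  · field_simp
    linear_combination -hs2

/-- in the real regime, `ε₀/ε₁ = −(1+z₁)/(1−z₁)·(1 + O(w^{−1/2}))`. -/
theorem ratio_eps0_eps1 (ω τ : ℝ) (hω0 : 0 < ω) (hω : ω < 1 / 2)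
    (hτ0 : 0 < τ) (hτ : τ < 1 / 2 - Real.sqrt (ω - ω ^ 2)) :
    ∃ C > (0 : ℝ), ∃ N : ℕ, ∀ n ≥ N,
      let w : ℕ := ⌊ω * n⌋₊
      let t : ℕ := ⌊τ * n⌋₊
      let m : ℝ := (n : ℝ) - 1
      let v : ℝ := (w : ℝ) - 1
      let ν : ℝ := v / m
      let α : ℝ := 1 / ν
      let σ₁ : ℝ := ((t : ℝ) - 1) / m
      let Δ₁ : ℝ := α - 2 * σ₁ / ν
      let D₁ : ℝ := Δ₁ ^ 2 - 4 * (α - 1)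
      let z₁ : ℝ := (-Δ₁ + Real.sqrt D₁) / (2 * (α - 1))
      z₁ ∈ Set.Ioo (-1 : ℝ) 0 ∧
      |(eps0 n w t / eps1 n w t) * (1 - z₁) / (1 + z₁) + 1| ≤ C / Real.sqrt w := by
  have hroot : 0 ≤ √(ω - ω ^ 2) := Real.sqrt_nonneg _
  have hroot2 : √(ω - ω ^ 2) ^ 2 = ω - ω ^ 2 := Real.sq_sqrt (by nlinarith)
  have hgap : 0 < (1 - 2 * ω) ^ 2 - 4 * τ * (1 - τ) := by nlinarith
  obtain ⟨κ, hκ, hκ2⟩ : ∃ κ : ℝ, 0 < κ ∧ κ ^ 2 = (1 - 2 * ω) ^ 2 - 4 * τ * (1 - τ) :=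
    ⟨_, Real.sqrt_pos.2 hgap, Real.sq_sqrt hgap.le⟩
  refine ⟨8 / κ ^ 3, by positivity, max 5 (max ⌈2 / κ + 1⌉₊ (max ⌈2 / ω⌉₊ ⌈1 / τ⌉₊)), ?_⟩
  intro n hn w t m v ν α σ₁ Δ₁ D₁ z₁
  simp only [ge_iff_le, max_le_iff, Nat.ceil_le] at hn
  obtain ⟨hn5, hnκ, hnω, hnτ⟩ := hn
  have hn5' : (5 : ℝ) ≤ n := by exact_mod_cast hn5
  rw [div_le_iff₀' hω0] at hnω
  rw [div_le_iff₀' hτ0] at hnτ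
  have hw2 : 2 ≤ w := Nat.le_floor (by exact_mod_cast hnω)
  have ht1 : 1 ≤ t := Nat.le_floor (by exact_mod_cast hnτ)
  have hwn : (w : ℝ) ≤ ω * n := Nat.floor_le (by positivity)
  have htn : (t : ℝ) ≤ τ * n := Nat.floor_le (by positivity)
  have hm4 : 4 ≤ m := by simp only [m]; linarith
  have hκm : 2 ≤ κ * m := by
    rw [← div_le_iff₀' hκ]; simp only [m]; linarith
  clear_value w t
  obtain ⟨v', rfl⟩ : ∃ v', w = v' + 1 := ⟨w - 1, by omega⟩
  obtain ⟨K, rfl⟩ : ∃ K, t = K + 1 := ⟨t - 1, by omega⟩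
  obtain ⟨M, rfl⟩ : ∃ M, n = M + 1 := ⟨n - 1, by omega⟩
  have hmM : m = M := by simp [m]
  have hvv : v = v' := by simp [v]
  push_cast at hwn htn
  rw [← hmM] at hwn htn
  rw [← hvv] at hwn
  have hv0 : 0 < v := by rw [hvv]; exact_mod_cast (by omega : 0 < v')
  have hτ2 : τ < 1 / 2 := by linarith
  have hvω : v ≤ ω * m := by linarith
  have hKτ : (K : ℝ) ≤ τ * m := by linarith
  have hK0 : (0 : ℝ) ≤ K := K.cast_nonneg
  have hm0 : 0 < m := by linarith
  have hωm : 0 < (1 - 2 * ω) * m := mul_pos (by linarith) hm0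
  have hτm : 0 < (1 - 2 * τ) * m := mul_pos (by linarith) hm0
  have hv2 : 2 * v ≤ m := by linarith
  have hK2 : 2 * (K : ℝ) < m := by linarith
  have hreg : RootRegime κ m (m - 2 * v) K := by
    refine ⟨hκ, hκm, hm4, by linarith, by linarith, hK0, hK2.le, ?_⟩
    have e1 : (1 - 2 * ω) ^ 2 * m ^ 2 ≤ (m - 2 * v) ^ 2 := by
      rw [← mul_pow]
      exact pow_le_pow_left₀ hωm.le (by linarith) 2
    have e2 : 4 * K * (m - K) ≤ 4 * τ * (1 - τ) * m ^ 2 := by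
      linarith [mul_nonneg (by linarith : 0 ≤ τ * m - K) (by linarith : 0 ≤ m - τ * m - K)]
    rw [mul_pow, hκ2]
    linarith
  have hvM : v' ≤ M := by
    have : (v' : ℝ) ≤ M := by rw [← hvv, ← hmM]; linarith
    exact_mod_cast this
  have hKM : K + 1 ≤ M := by
    have : (K : ℝ) + 1 ≤ M := by rw [← hmM]; linarith
    exact_mod_cast this
  have hc : (0 : ℝ) < M.choose v' := by exact_mod_cast Nat.choose_pos hvM
  obtain ⟨hpK, hlow, hup⟩ := ratio_bounds_of_recurrence (p := krawtchouk M v') hreg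
    (by rw [krawtchouk_zero_right]; exact hc)
    (by rw [hmM, hvv]; exact krawtchouk_one_right v' (by omega))
    (fun k hk => by rw [hmM, hvv]; exact krawtchouk_add_two v' (by omega)) K le_rfl
  have hR := hreg.largeRoot_pos
  have hRκ := hreg.kappa_le_largeRoot
  have hzeq : z₁ = (-(m - 2 * K) + √((m - 2 * v) ^ 2 - 4 * K * (m - K))) / (2 * (m - v)) := by
    have hmv : m - v ≠ 0 := by linarith
    have hΔ : Δ₁ = (m - 2 * K) / v := by
      simp only [Δ₁, α, ν, σ₁]
      push_cast
      field_simp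
      ring
    have hα : α - 1 = (m - v) / v := by
      simp only [α, ν]
      field_simp
    have hD : D₁ = ((m - 2 * v) ^ 2 - 4 * K * (m - K)) / v ^ 2 := by
      simp only [D₁]
      rw [hΔ, hα]
      field_simp
      ring
    simp only [z₁]
    rw [hD, hΔ, hα, Real.sqrt_div' _ (sq_nonneg v), Real.sqrt_sq hv0.le]
    field_simp
  obtain ⟨hz, hRz⟩ := saddle_point_mem_and_eq hv0 hv2 hK0 hK2
    (by linarith [hreg.le_sqrt]) hreg.sq_sqrt hzeq
  refine ⟨hz, ?_⟩
  change largeRoot m (m - 2 * v) K * (1 - z₁) = 1 + z₁ at hRz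
  rw [eps1_eq_krawtchouk hvM (by omega), eps0_eq_krawtchouk hvM hKM]
  clear_value z₁
  generalize largeRoot m (m - 2 * v) K = R at *
  have hz1 : 0 < 1 - z₁ := by linarith [hz.2]
  have hexpr : -(krawtchouk M v' (K + 1) / (2 * (M.choose v' : ℝ))) /
      (krawtchouk M v' K / (2 * (M.choose v' : ℝ))) * (1 - z₁) / (1 + z₁) + 1 =
      -((krawtchouk M v' (K + 1) - R * krawtchouk M v' K) / (R * krawtchouk M v' K)) := by
    rw [← hRz]
    field_simp
    ring
  rw [hexpr, abs_neg, abs_of_nonneg (div_nonneg (by linarith) (by positivity))]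
  have hw1 : (1 : ℝ) ≤ ((v' + 1 : ℕ) : ℝ) := by push_cast; linarith [v'.cast_nonneg (α := ℝ)]
  have hsw : √((v' + 1 : ℕ) : ℝ) ≤ m := by
    refine (Real.sqrt_le_iff.2 ⟨by positivity, by nlinarith⟩ : _ ≤ ((v' + 1 : ℕ) : ℝ)).trans ?_
    push_cast
    rw [← hvv]
    linarith
  have hsw0 : 0 < √((v' + 1 : ℕ) : ℝ) := Real.sqrt_pos.2 (by linarith)
  calc (krawtchouk M v' (K + 1) - R * krawtchouk M v' K) / (R * krawtchouk M v' K)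
      ≤ (8 / (κ ^ 2 * m) * krawtchouk M v' K) / (κ * krawtchouk M v' K) :=
        div_le_div₀ (by positivity) (by linarith) (by positivity)
          (mul_le_mul_of_nonneg_right hRκ hpK.le)
    _ = 8 / κ ^ 3 / m := by field_simp
    _ ≤ 8 / κ ^ 3 / √((v' + 1 : ℕ) : ℝ) := div_le_div_of_nonneg_left (by positivity) hsw0 hsw
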